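/- Let P ⊆ ℝ^n be a nonempty compact convex set, L ⊆ ℝ^m a nonempty bounded convex set, ũ(p,ℓ)_{jk} = p_j ℓ_k the basis map, v_1, …, v_d ∈ ℝ^{nm}, f(x) = max( max_{i ∈ [d]} ⟨v_i, x⟩, 0 ), and T*_f = {θ : ∀ x, ⟨θ, x⟩ ≤ f(x)}. Assume that for every ℓ ∈ L there exists p ∈ P with ⟨v_i, ũ(p, ℓ)⟩ ≤ 0 for all i ∈ [d]. Then for every θ̃ ∈ T*_f there exists a single p ∈ P such that ⟨θ̃, ũ(p, ℓ)⟩ ≤ 0 for all ℓ ∈ L. -/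

import Mathlib

/-- If `B` is bilinear and separately continuous, `P` is compact convex and `L` is convex, then
pointwise responses `p ∈ P` with `B p ℓ ≤ 0` can be replaced by a single uniform one. -/
theorem LinearMap.exists_forall_nonpos_of_forall_exists_nonpos {E F : Type*}
    [TopologicalSpace E] [AddCommGroup E] [Module ℝ E] [IsTopologicalAddGroup E]
    [ContinuousSMul ℝ E]
    [TopologicalSpace F] [AddCommGroup F] [Module ℝ F] [IsTopologicalAddGroup F]
    [ContinuousSMul ℝ F]
    (B : E →ₗ[ℝ] F →ₗ[ℝ] ℝ) (hB₁ : ∀ y, Continuous fun x => B x y) (hB₂ : ∀ x, Continuous (B x))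
    {P : Set E} {L : Set F} (hP_ne : P.Nonempty) (hP_cpt : IsCompact P) (hP_conv : Convex ℝ P)
    (hL_conv : Convex ℝ L) (h : ∀ ℓ ∈ L, ∃ p ∈ P, B p ℓ ≤ 0) :
    ∃ p ∈ P, ∀ ℓ ∈ L, B p ℓ ≤ 0 := by
  by_contra! hcon
  obtain ⟨s, hsL, hs, hcover⟩ := hP_cpt.elim_finite_subcover_image (b := L)
    (c := fun ℓ => {p | 0 < B p ℓ}) (fun ℓ _ => isOpen_lt continuous_const (hB₁ ℓ))
    (fun p hp => by simpa using hcon p hp)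
  obtain ⟨ℓ, hℓ, hpos⟩ := Sion.exists_lt_iInf_of_lt_iInf_of_finite (f := fun p ℓ => B p ℓ) (t := 0)
    hP_ne hP_cpt
    (fun y _ => (hB₁ y).lowerSemicontinuous.lowerSemicontinuousOn P)
    (fun y _ => ((B.flip y).convexOn hP_conv).quasiconvexOn)
    hL_conv
    (fun x _ => (hB₂ x).upperSemicontinuous.upperSemicontinuousOn L)
    (fun x _ => ((B x).concaveOn hL_conv).quasiconcaveOn)
    hP_conv hs hsL (fun p hp => by simpa using hcover hp)
  obtain ⟨p, hp, hle⟩ := h ℓ hℓ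
  exact (hpos p hp).not_ge hle


/-- **Uniform-response separability for the dual set (via the minimax theorem).**
With the basis map `ũ(p,ℓ)_{jk} = p_j ℓ_k`, pseudonorm `f x = max(max_i ⟨v_i, x⟩, 0)`
and dual set `T*_f = {θ | ∀ x, ⟨θ, x⟩ ≤ f x}`: assuming separability
(for every `ℓ ∈ L` some `p ∈ P` has `⟨v_i, ũ(p,ℓ)⟩ ≤ 0` for all `i`),
for every `θ̃ ∈ T*_f` there exists a single `p ∈ P` with `⟨θ̃, ũ(p,ℓ)⟩ ≤ 0` for all `ℓ ∈ L`. -/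
theorem dual_separability_uniform_response (n m d : ℕ) (hd : 0 < d)
    (P : Set (Fin n → ℝ)) (L : Set (Fin m → ℝ))
    (hP_ne : P.Nonempty) (hP_cpt : IsCompact P) (hP_conv : Convex ℝ P)
    (hL_ne : L.Nonempty) (hL_bdd : Bornology.IsBounded L) (hL_conv : Convex ℝ L)
    (v : Fin d → Fin n → Fin m → ℝ)
    (hsep : ∀ ℓ ∈ L, ∃ p ∈ P, ∀ i, (∑ j, ∑ k, v i j k * (p j * ℓ k)) ≤ 0)
    (θ : Fin n → Fin m → ℝ)
    (hθ : ∀ x : Fin n → Fin m → ℝ,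
        (∑ j, ∑ k, θ j k * x j k) ≤
          max (Finset.univ.sup' ⟨⟨0, hd⟩, Finset.mem_univ _⟩
            (fun i => ∑ j, ∑ k, v i j k * x j k)) 0) :
    ∃ p ∈ P, ∀ ℓ ∈ L, (∑ j, ∑ k, θ j k * (p j * ℓ k)) ≤ 0 := by
  have hB (p : Fin n → ℝ) (ℓ : Fin m → ℝ) :
      Matrix.toLinearMap₂' ℝ (Matrix.of θ) p ℓ = ∑ j, ∑ k, θ j k * (p j * ℓ k) := by
    simp only [Matrix.toLinearMap₂'_apply, Matrix.of_apply, smul_eq_mul]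
    exact Finset.sum_congr rfl fun j _ => Finset.sum_congr rfl fun k _ => by ring
  simp only [← hB]
  refine LinearMap.exists_forall_nonpos_of_forall_exists_nonpos
    (Matrix.toLinearMap₂' ℝ (Matrix.of θ))
    (fun ℓ => ((Matrix.toLinearMap₂' ℝ (Matrix.of θ)).flip ℓ :
      (Fin n → ℝ) →ₗ[ℝ] ℝ).continuous_of_finiteDimensional)
    (fun p => LinearMap.continuous_of_finiteDimensional _) hP_ne hP_cpt hP_conv hL_conv
    fun ℓ hℓ => ?_
  obtain ⟨p, hp, hv⟩ := hsep ℓ hℓ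
  refine ⟨p, hp, ?_⟩
  rw [hB]
  exact (hθ fun j k => p j * ℓ k).trans
    (max_le (Finset.sup'_le _ _ fun i _ => hv i) le_rfl)
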